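/- Let A be a graded artinian Gorenstein algebra over a field of characteristic zero with h-vector (1, 5, 6, 5, 1). Then A has the weak Lefschetz property. -/

import Mathlib

open MvPolynomial

noncomputable section

variable {K : Type*} [Field K] {n : ℕ}

/-- The degree `i` graded piece of the standard graded algebra `R/I`,
where `R = K[x_1,…,x_n]`. -/
def piece (I : Ideal (MvPolynomial (Fin n) K)) (i : ℕ) :
    Submodule K (MvPolynomial (Fin n) K ⧸ I) :=
  (homogeneousSubmodule (Fin n) K i).map (Ideal.Quotient.mkₐ K I).toLinearMap

/-- The Hilbert function of the standard graded algebra `R/I`. -/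
def hf (I : Ideal (MvPolynomial (Fin n) K)) (i : ℕ) : ℕ :=
  Module.finrank K (piece I i)

/-- `I` is a homogeneous ideal. -/
def IsHomogIdeal (I : Ideal (MvPolynomial (Fin n) K)) : Prop :=
  ∀ p ∈ I, ∀ i : ℕ, homogeneousComponent i p ∈ I

/-- The socle of `R/I`: the annihilator of the irrelevant maximal ideal. -/
def socle (I : Ideal (MvPolynomial (Fin n) K)) :
    Submodule K (MvPolynomial (Fin n) K ⧸ I) :=
  ⨅ j : Fin n, LinearMap.ker (LinearMap.mulLeft K (Ideal.Quotient.mk I (X j)))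

/-- `R/I` is a standard graded artinian Gorenstein algebra of socle degree `d`:
`I` is homogeneous, the Hilbert function vanishes above degree `d`, is symmetric,
and the socle is one-dimensional, concentrated in degree `d`. -/
def IsArtinianGorenstein (I : Ideal (MvPolynomial (Fin n) K)) (d : ℕ) : Prop :=
  IsHomogIdeal I ∧ hf I d = 1 ∧ (∀ i : ℕ, d < i → hf I i = 0) ∧
    (∀ i : ℕ, i ≤ d → hf I i = hf I (d - i)) ∧
    Module.finrank K (socle I) = 1 ∧ socle I ≤ piece I d

/-- The weak Lefschetz property for `R/I`: there is a linear form `ℓ` such that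
multiplication `×ℓ : [A]_i → [A]_{i+1}` has maximal rank (is injective or
surjective) for every `i`. -/
def WLP (I : Ideal (MvPolynomial (Fin n) K)) : Prop :=
  ∃ ℓ : MvPolynomial (Fin n) K, ℓ.IsHomogeneous 1 ∧ ∀ i : ℕ,
    (∀ a ∈ piece I i, Ideal.Quotient.mk I ℓ * a = 0 → a = 0) ∨
    (∀ b ∈ piece I (i + 1), ∃ a ∈ piece I i, Ideal.Quotient.mk I ℓ * a = b)

/-- The strong Lefschetz property for `R/I`: there is a linear form `ℓ` such that
`×ℓ^k : [A]_i → [A]_{i+k}` has maximal rank for all `i ≥ 0`, `k ≥ 1`. -/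
def SLP (I : Ideal (MvPolynomial (Fin n) K)) : Prop :=
  ∃ ℓ : MvPolynomial (Fin n) K, ℓ.IsHomogeneous 1 ∧ ∀ i k : ℕ, 1 ≤ k →
    ((∀ a ∈ piece I i, Ideal.Quotient.mk I ℓ ^ k * a = 0 → a = 0) ∨
     (∀ b ∈ piece I (i + k), ∃ a ∈ piece I i, Ideal.Quotient.mk I ℓ ^ k * a = b))

/-- The action of `p ∈ R = K[x_1,…,x_n]` on `S = K[X_1,…,X_n]` by differentiation,
`x_i` acting as `∂/∂X_i`. -/
def diffOp (p : MvPolynomial (Fin n) K) :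
    Module.End K (MvPolynomial (Fin n) K) :=
  ∑ m ∈ p.support, MvPolynomial.coeff m p •
    (List.ofFn fun j : Fin n =>
      ((pderiv j).toLinearMap : Module.End K (MvPolynomial (Fin n) K)) ^ (m j)).prod

/-- The degree-`d` graded piece of the inverse system `I^⊥ = {F : g ∘ F = 0 ∀ g ∈ I}`. -/
def invSys (I : Ideal (MvPolynomial (Fin n) K)) (d : ℕ) :
    Submodule K (MvPolynomial (Fin n) K) :=
  homogeneousSubmodule (Fin n) K d ⊓ ⨅ g ∈ I, LinearMap.ker (diffOp g)

end


section Core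

lemma rk_strict {S M : Type*} [CommRing S] [IsDomain S] [IsNoetherianRing S] [AddCommGroup M]
    [Module S M] (P N : Submodule S M) [Module.Finite S N] (h : P ≤ N) (y : M) (hy : y ∈ N)
    (hyP : ∀ g : S, g • y ∈ P → g = 0) : Module.finrank S P + 1 ≤ Module.finrank S N := by
  have h1 := Submodule.finrank_quotient_add_finrank (Submodule.comap N.subtype P)
  have h2 : Module.finrank S (Submodule.comap N.subtype P) = Module.finrank S P :=
    (Submodule.comapSubtypeEquivOfLe h).finrank_eq
  have h3 : LinearIndependent S
      (fun _ : Fin 1 => (Submodule.Quotient.mk (p := Submodule.comap N.subtype P) ⟨y, hy⟩)) := by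
    rw [Fintype.linearIndependent_iff]
    intro g hg i
    simp only [Finset.univ_unique, Finset.sum_singleton] at hg
    rw [← Submodule.Quotient.mk_smul, Submodule.Quotient.mk_eq_zero] at hg
    have := hyP _ hg
    rwa [Subsingleton.elim i default]
  have h4 := h3.fintype_card_le_finrank
  simp at h4
  omega

lemma rk_nullity {S M M' : Type*} [CommRing S] [IsDomain S] [IsNoetherianRing S] [AddCommGroup M]
    [Module S M] [AddCommGroup M'] [Module S M'] [Module.Finite S M] (f : M →ₗ[S] M') :
    Module.finrank S (LinearMap.range f) + Module.finrank S (LinearMap.ker f)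
      = Module.finrank S M := by
  rw [← f.quotKerEquivRange.finrank_eq, Submodule.finrank_quotient_add_finrank]

lemma nat_cancel {S B : Type*} [CommRing S] [IsDomain S] [CharZero S]
    [CommRing B] [Algebra S B] [Module.IsTorsionFree S B] (n : ℕ) (hn : n ≠ 0) (b : B) (h : (n : B) * b = 0) : b = 0 := by
  have : (n : S) • b = 0 := by rw [Algebra.smul_def]; simpa using h
  rcases smul_eq_zero.1 this with h | h
  · exact absurd (by exact_mod_cast h) hn
  · exact h

lemma am_cancel {S B : Type*} [CommRing S] [IsDomain S]
    [CommRing B] [Algebra S B] [Module.IsTorsionFree S B] (s : S) (b : B) (hb : b ≠ 0) (h : algebraMap S B s * b = 0) : s = 0 := by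
  rw [← Algebra.smul_def] at h
  exact (smul_eq_zero.1 h).resolve_right hb

theorem core {S B : Type*} [CommRing S] [IsDomain S] [IsNoetherianRing S] [CharZero S]
    [CommRing B] [Algebra S B] [Module.IsTorsionFree S B] (x : Fin 5 → B) (t : Fin 5 → S) (D : Fin 5 → Derivation ℤ B B)
    (hD : ∀ i j, D i (x j) = 0)
    (hV : ∀ i, ∀ b ∈ Submodule.span S (Set.range x), D i b ∈ Submodule.span S (Set.range x))
    (l m : B) (hl : l = ∑ i, t i • x i) (hDl : ∀ i, D i l = x i)
    (hm : m ∈ Submodule.span S (Set.range x)) (hm0 : m ≠ 0) (hlm : l * m = 0)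
    (hA1 : ∀ a ∈ Submodule.span S (Set.range x), (∀ i, a * x i = 0) → a = 0)
    (hA2 : ∀ a ∈ Submodule.span S (Set.range x), ∀ b ∈ Submodule.span S (Set.range x),
      (∀ i, a * b * x i = 0) → a * b = 0)
    (hA3 : ∀ a ∈ Submodule.span S (Set.range x), ∀ b ∈ Submodule.span S (Set.range x),
      ∀ c ∈ Submodule.span S (Set.range x), (∀ i, a * b * c * x i = 0) → a * b * c = 0)
    (hl2 : l * l ≠ 0) (hE : ∑ i, t i • D i m ≠ 0) : False := by
  set V := Submodule.span S (Set.range x) with hVdef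
  have xV : ∀ i, x i ∈ V := fun i => Submodule.subset_span ⟨i, rfl⟩
  have lV : l ∈ V := by
    rw [hl]; exact Submodule.sum_mem _ fun i _ => V.smul_mem _ (xV i)
  have : Module.Finite S V := Module.Finite.span_of_finite S (Set.finite_range x)
  -- basic identities
  have e1 : ∀ i, x i * m + l * D i m = 0 := by
    intro i
    have := congrArg (D i) hlm
    simp only [Derivation.leibniz, smul_eq_mul, map_zero, hDl] at this
    linear_combination this
  have e2 : m * m = 0 := by
    apply hA2 m hm m hm
    intro i
    linear_combination m * e1 i - D i m * hlm
  have e3 : ∀ i, m * D i m = 0 := by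
    intro i
    have := congrArg (D i) e2
    simp only [Derivation.leibniz, smul_eq_mul, map_zero] at this
    apply nat_cancel (S := S) 2 (by norm_num)
    push_cast
    linear_combination this
  have e4 : ∀ i j, D i m * D j m + m * D i (D j m) = 0 := by
    intro i j
    have := congrArg (D i) (e3 j)
    simp only [Derivation.leibniz, smul_eq_mul, map_zero] at this
    linear_combination this
  have e7 : ∀ i j, x i * D j m + x j * D i m + l * D i (D j m) = 0 := by
    intro i j
    have := congrArg (D i) (e1 j)
    simp only [Derivation.leibniz, smul_eq_mul, map_zero, hDl, map_add, hD] at this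
    linear_combination this
  have e8 : ∀ i j k, x i * (m * D k (D j m)) + x j * (m * D k (D i m))
      + x k * m * D i (D j m) = 0 := by
    intro i j k
    linear_combination x i * e4 k j + x j * e4 k i + D i (D j m) * e1 k - D k m * e7 i j
  -- l is not in T
  have hT : ∀ (g : S) (u : Fin 5 → S), g • l = ∑ k, u k • D k m → g = 0 := by
    intro g u hu
    by_contra hg
    simp only [Algebra.smul_def] at hu
    set u' : B := ∑ k, algebraMap S B (u k) * x k with hu'
    set G := algebraMap S B g with hG
    have hGc : ∀ b : B, G * b = 0 → b = 0 := by
      intro b hb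
      by_contra hb0
      exact hg (am_cancel g b hb0 hb)
    have u'V : u' ∈ V := Submodule.sum_mem _ fun i _ => by
      rw [← Algebra.smul_def]; exact V.smul_mem _ (xV i)
    have f1 : ∀ i, G * x i * m = ∑ k, algebraMap S B (u k) * (m * D k (D i m)) := by
      intro i
      have a1 : ∑ k, algebraMap S B (u k) * (m * D k (D i m))
          = - ((∑ k, algebraMap S B (u k) * D k m) * D i m) := by
        rw [Finset.sum_mul, ← Finset.sum_neg_distrib]
        refine Finset.sum_congr rfl fun k _ => ?_
        linear_combination algebraMap S B (u k) * e4 k i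
      rw [a1, ← hu]
      linear_combination G * e1 i
    have f2 : ∀ i j, 2 * G * x i * x j * m + u' * (m * D i (D j m)) = 0 := by
      intro i j
      have : ∑ k, algebraMap S B (u k) * (x i * (m * D k (D j m)) + x j * (m * D k (D i m))
        + x k * m * D i (D j m)) = 0 := by simp [e8]
      have a2 : ∑ k, algebraMap S B (u k) * (x i * (m * D k (D j m)) + x j * (m * D k (D i m))
        + x k * m * D i (D j m)) = x i * ∑ k, algebraMap S B (u k) * (m * D k (D j m))
          + x j * ∑ k, algebraMap S B (u k) * (m * D k (D i m)) + u' * (m * D i (D j m)) := by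
        rw [hu', Finset.sum_mul, Finset.mul_sum, Finset.mul_sum, ← Finset.sum_add_distrib,
          ← Finset.sum_add_distrib]
        refine Finset.sum_congr rfl fun k _ => by ring
      rw [a2, ← f1, ← f1] at this
      linear_combination this
    have f3 : ∀ j, u' * m * x j = 0 := by
      intro j
      have : ∑ i, algebraMap S B (u i) * (2 * G * x i * x j * m + u' * (m * D i (D j m))) = 0 := by
        simp [f2]
      have a3 : ∑ i, algebraMap S B (u i) * (2 * G * x i * x j * m + u' * (m * D i (D j m)))
          = 2 * G * x j * m * u' + u' * ∑ i, algebraMap S B (u i) * (m * D i (D j m)) := by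
        conv_rhs => rw [hu', Finset.mul_sum]
        rw [← hu', Finset.mul_sum, ← Finset.sum_add_distrib]
        refine Finset.sum_congr rfl fun k _ => by ring
      rw [a3, ← f1] at this
      apply nat_cancel (S := S) 3 (by norm_num)
      apply hGc
      push_cast
      linear_combination this
    have f4 : u' * m = 0 := hA2 _ u'V _ hm f3
    have f5 : u' * m = - (l * ∑ k, algebraMap S B (u k) * D k m) := by
      rw [hu', Finset.mul_sum, Finset.sum_mul, ← Finset.sum_neg_distrib]
      refine Finset.sum_congr rfl fun k _ => ?_
      linear_combination algebraMap S B (u k) * e1 k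
    rw [← hu, f4] at f5
    apply hl2
    apply hGc
    linear_combination f5
  -- rank argument
  let E : (Fin 5 → S) →ₗ[S] B := Fintype.linearCombination S x
  let μ : (Fin 5 → S) →ₗ[S] B := Fintype.linearCombination S (fun i => x i * m)
  let Δ : (Fin 5 → S) →ₗ[S] B := Fintype.linearCombination S (fun i => D i m)
  have hEμ : ∀ v, E v * m = μ v := by
    intro v
    simp only [E, μ, Fintype.linearCombination_apply, Finset.sum_mul, smul_mul_assoc]
  have hμΔ : ∀ v, μ v = - (l * Δ v) := by
    intro v
    simp only [μ, Δ, Fintype.linearCombination_apply, Finset.mul_sum, ← Finset.sum_neg_distrib]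
    refine Finset.sum_congr rfl fun k _ => ?_
    rw [Algebra.smul_def, Algebra.smul_def]
    linear_combination algebraMap S B (v k) * e1 k
  have hErange : ∀ b ∈ V, ∃ v, E v = b := by
    intro b hb
    have : V = LinearMap.range E := by
      rw [Fintype.range_linearCombination]
    rw [this] at hb
    exact hb
  have hEt : E t = l := by simp [E, Fintype.linearCombination_apply, hl]
  have r1 : Module.finrank S (LinearMap.ker Δ) + 1 ≤ Module.finrank S (LinearMap.ker μ) := by
    apply rk_strict _ _ _ t
    · rw [LinearMap.mem_ker, ← hEμ, hEt, hlm]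
    · intro g hg
      rw [LinearMap.mem_ker, map_smul] at hg
      refine (smul_eq_zero.1 hg).resolve_right ?_
      simpa [Δ, Fintype.linearCombination_apply] using hE
    · intro v hv
      rw [LinearMap.mem_ker] at hv ⊢
      rw [hμΔ, hv]; simp
  have r2 := rk_nullity Δ
  have r3 := rk_nullity μ
  have r4 : Module.finrank S (LinearMap.range Δ) + 1
      ≤ Module.finrank S ((LinearMap.ker μ).map E) := by
    apply rk_strict _ _ _ l
    · exact ⟨t, by simp only [SetLike.mem_coe]; rw [LinearMap.mem_ker, ← hEμ, hEt, hlm], hEt⟩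
    · rintro g ⟨u, hu⟩
      apply hT g u
      rw [← hu]
      simp [Δ, Fintype.linearCombination_apply]
    · rintro _ ⟨u, rfl⟩
      have : Δ u ∈ V := by
        simp only [Δ, Fintype.linearCombination_apply]
        exact Submodule.sum_mem _ fun i _ => V.smul_mem _ (hV i m hm)
      obtain ⟨v, hv⟩ := hErange _ this
      refine ⟨v, ?_, hv⟩
      simp only [SetLike.mem_coe]
      rw [LinearMap.mem_ker, ← hEμ, hv]
      simp only [Δ, Fintype.linearCombination_apply, Finset.sum_mul, smul_mul_assoc]
      refine Finset.sum_eq_zero fun k _ => ?_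
      rw [mul_comm, e3, smul_zero]
  have r5 := Submodule.finrank_map_le E (LinearMap.ker μ)
  have r6 : Module.finrank S (Fin 5 → S) = 5 := by simp
  have r7 : Module.finrank S (LinearMap.range μ) ≤ 1 := by omega
  -- choose direction
  obtain ⟨i, hi⟩ : ∃ i, m * x i ≠ 0 := by
    by_contra! h
    exact hm0 (hA1 m hm h)
  set v := x i with hv
  have dep : ∀ w ∈ V, ∃ a b : S, b ≠ 0 ∧
      algebraMap S B b * (w * m) = algebraMap S B a * (v * m) := by
    intro w hw
    have hnot : ¬ LinearIndependent S ![(⟨w * m, by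
        obtain ⟨c, rfl⟩ := hErange w hw; exact ⟨c, (hEμ c).symm⟩⟩ : LinearMap.range μ),
        ⟨v * m, by obtain ⟨c, hc⟩ := hErange v (xV i); exact ⟨c, by rw [← hEμ c, hc]⟩⟩] := by
      intro h
      have := h.fintype_card_le_finrank
      simp at this
      omega
    rw [LinearIndependent.pair_iff] at hnot
    push Not at hnot
    obtain ⟨b, a, hab, h0⟩ := hnot
    have hab' : b • (w * m) + a • (v * m) = 0 := by simpa using congrArg Subtype.val hab
    rw [Algebra.smul_def, Algebra.smul_def] at hab'
    refine ⟨-a, b, ?_, ?_⟩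
    · rintro rfl
      apply h0 rfl
      apply am_cancel a (v * m) (by rwa [mul_comm])
      simpa using hab'
    · rw [map_neg]
      linear_combination hab'
  have up : ∀ w ∈ V, ∀ c : B, c * (v * m) = 0 → c * (w * m) = 0 := by
    intro w hw c hc
    obtain ⟨a, b, hb, h⟩ := dep w hw
    by_contra hne
    apply hb
    apply am_cancel b _ hne
    linear_combination c * h + algebraMap S B a * hc
  have hv3 : v * v * v * m ≠ 0 := by
    intro h
    have g1 : ∀ j, v * v * (x j * m) = 0 := fun j => up _ (xV j) _ (by linear_combination h)
    have g2 : ∀ j k, v * x j * (x k * m) = 0 := fun j k =>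
      up _ (xV k) _ (by linear_combination g1 j)
    have g3 : ∀ j k n, x j * x k * (x n * m) = 0 := fun j k n =>
      up _ (xV n) _ (by linear_combination g2 j k)
    apply hm0
    apply hA1 _ hm
    intro j
    apply hA2 _ hm _ (xV j)
    intro k
    apply hA3 _ hm _ (xV j) _ (xV k)
    intro n
    linear_combination g3 j k n
  have hv2 : v * v * m ≠ 0 := by
    intro h
    apply hv3
    linear_combination v * h
  have down : ∀ w ∈ V, v * (w * m) = 0 → w * m = 0 := by
    intro w hw h
    obtain ⟨a, b, hb, hab⟩ := dep w hw
    have ha : a = 0 := by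
      apply am_cancel a _ hv2
      linear_combination algebraMap S B b * h - v * hab
    by_contra hne
    apply hb
    apply am_cancel b _ hne
    rw [hab, ha]; simp
  -- iterated derivatives
  let M : ℕ → B := fun j => (D i)^[j] m
  have M0 : M 0 = m := rfl
  have Ms : ∀ j, D i (M j) = M (j + 1) := fun j => (Function.iterate_succ_apply' _ _ _).symm
  have MV : ∀ j, M j ∈ V := by
    intro j
    induction j with
    | zero => exact hm
    | succ j ih => rw [← Ms]; exact hV i _ ih
  have lM : ∀ j, l * M (j + 1) + ((j + 1 : ℕ) : B) * (v * M j) = 0 := by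
    intro j
    induction j with
    | zero =>
      have := e1 i
      rw [← Ms 0, M0]; push_cast
      linear_combination this
    | succ j ih =>
      have := congrArg (D i) ih
      simp only [Derivation.leibniz, smul_eq_mul, map_zero, hDl, map_add, hD, Ms, hv,
        Derivation.map_natCast] at this
      push_cast at this ⊢
      linear_combination this
  have mM : ∀ j, m * M j = 0 := by
    intro j
    induction j with
    | zero => exact e2
    | succ j ih =>
      have h1 := congrArg (D i) ih
      simp only [Derivation.leibniz, smul_eq_mul, map_zero, Ms] at h1
      have h2 : D i m = M 1 := Ms 0
      rw [h2] at h1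
      have h3 := lM 0
      have h4 := lM j
      rw [M0] at h3
      rw [mul_comm]
      apply down _ (MV _)
      apply nat_cancel (S := S) (j + 2) (by omega)
      push_cast at h3 h4 ⊢
      linear_combination M (j+1) * h3 - M 1 * h4 + (j + 1) * v * h1
  have m1M : ∀ j, M 1 * M j = 0 := by
    intro j
    have h1 := congrArg (D i) (mM j)
    simp only [Derivation.leibniz, smul_eq_mul, map_zero, Ms] at h1
    have h2 : D i m = M 1 := Ms 0
    rw [h2] at h1
    linear_combination h1 - mM (j+1)
  have l1 := lM 0
  have l2 := lM 1
  have l3 := lM 2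
  rw [M0] at l1
  norm_num at l1 l2 l3
  -- six independent vectors
  have ind : LinearIndependent S ![(⟨v, xV i⟩ : V), ⟨l, lV⟩, ⟨m, hm⟩, ⟨M 1, MV 1⟩, ⟨M 2, MV 2⟩,
      ⟨M 3, MV 3⟩] := by
    rw [Fintype.linearIndependent_iff]
    intro g hg
    have hg' := congrArg Subtype.val hg
    simp only [Fin.sum_univ_six, Submodule.coe_add, Submodule.coe_smul, Algebra.smul_def,
      Submodule.coe_zero] at hg'
    simp at hg'
    have k0 : g 0 = 0 := by
      apply am_cancel (g 0) (m * v) hi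
      linear_combination m * hg' - algebraMap S B (g 1) * hlm - algebraMap S B (g 2) * e2
        - algebraMap S B (g 3) * mM 1 - algebraMap S B (g 4) * mM 2 - algebraMap S B (g 5) * mM 3
    rw [k0, map_zero] at hg'
    have k1 : g 1 = 0 := by
      apply am_cancel (g 1) (m * v) hi
      linear_combination - M 1 * hg' + algebraMap S B (g 1) * l1 + algebraMap S B (g 2) * mM 1
        + algebraMap S B (g 3) * m1M 1 + algebraMap S B (g 4) * m1M 2
        + algebraMap S B (g 5) * m1M 3
    rw [k1, map_zero] at hg'
    have q1 : l * M 1 = - (v * m) := by linear_combination l1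
    have q2 : l * (l * M 2) = 2 * (v * v * m) := by linear_combination l * l2 - 2 * v * l1
    have q3 : l * (l * (l * M 3)) = - 6 * (v * v * v * m) := by
      linear_combination l * l * l3 - 3 * v * q2
    have k5 : g 5 = 0 := by
      apply am_cancel (g 5) _ hv3
      apply nat_cancel (S := S) 6 (by norm_num)
      push_cast
      linear_combination -l * l * l * hg' + algebraMap S B (g 5) * q3
        + algebraMap S B (g 4) * l * q2 + algebraMap S B (g 3) * l * l * q1
        + (l * l * algebraMap S B (g 2) + 2 * algebraMap S B (g 4) * v * v
            - algebraMap S B (g 3) * v * l) * hlm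
    rw [k5, map_zero] at hg'
    have k4 : g 4 = 0 := by
      apply am_cancel (g 4) _ hv3
      apply nat_cancel (S := S) 2 (by norm_num)
      push_cast
      linear_combination v * l * l * hg' - algebraMap S B (g 4) * v * q2
        - algebraMap S B (g 3) * v * l * q1
        + (-v * l * algebraMap S B (g 2) + algebraMap S B (g 3) * v * v) * hlm
    rw [k4, map_zero] at hg'
    have k3 : g 3 = 0 := by
      apply am_cancel (g 3) _ hv3
      linear_combination -v * v * l * hg' + algebraMap S B (g 3) * v * v * q1
        + v * v * algebraMap S B (g 2) * hlm
    rw [k3, map_zero] at hg'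
    have k2 : g 2 = 0 := by
      apply am_cancel (g 2) _ hv3
      linear_combination v * v * v * hg'
    intro j
    fin_cases j <;> assumption
  have c1 := ind.fintype_card_le_finrank
  have c2 : Module.finrank S V ≤ 5 := by
    have := finrank_range_le_card (R := S) x
    rw [Fintype.card_fin] at this
    exact this
  simp at c1
  omega

end Core
section Mid

lemma cmc {A : Type*} [CommRing A] (n : Fin 5 →₀ ℕ) (p : MvPolynomial (Fin 5) A) (a : A) :
    MvPolynomial.coeff n (p * MvPolynomial.C a) = MvPolynomial.coeff n p * a := by
  rw [mul_comm, MvPolynomial.coeff_C_mul, mul_comm]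

lemma sum3 {ι κ C : Type*} [Fintype ι] [Fintype κ] [AddCommMonoid C] (f : ι → ι → κ → C) :
    ∑ i, ∑ j, ∑ k, f i j k = ∑ k, ∑ j, ∑ i, f i j k := by
  rw [Finset.sum_comm]
  calc ∑ j, ∑ i, ∑ k, f i j k = ∑ j, ∑ k, ∑ i, f i j k :=
        Finset.sum_congr rfl fun j _ => Finset.sum_comm
    _ = _ := Finset.sum_comm

lemma torsion_aux {K A : Type*} [Field K] [CommRing A] [Nontrivial A] [Algebra K A]
    (s : MvPolynomial (Fin 5) K) (b : MvPolynomial (Fin 5) A)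
    (h : MvPolynomial.map (algebraMap K A) s * b = 0) : s = 0 ∨ b = 0 := by
  by_contra! hne
  obtain ⟨hs, hb⟩ := hne
  let o : MonomialOrder (Fin 5) := MonomialOrder.lex
  have hinj : Function.Injective (algebraMap K A) := (algebraMap K A).injective
  have hdeg : o.degree (MvPolynomial.map (algebraMap K A) s) = o.degree s := by
    unfold MonomialOrder.degree
    rw [MvPolynomial.support_map_of_injective _ hinj]
  have hc := o.coeff_mul_of_degree_add (f := MvPolynomial.map (algebraMap K A) s) (g := b)
  rw [h, MvPolynomial.coeff_zero] at hc
  have h1 : o.leadingCoeff (MvPolynomial.map (algebraMap K A) s)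
      = algebraMap K A (o.leadingCoeff s) := by
    rw [MonomialOrder.leadingCoeff, hdeg, MvPolynomial.coeff_map]; rfl
  have h2 : o.leadingCoeff s ≠ 0 := by
    rwa [Ne, MonomialOrder.leadingCoeff_eq_zero_iff]
  rw [h1] at hc
  have h3 : o.leadingCoeff b = 0 := by
    have hu : IsUnit (algebraMap K A (o.leadingCoeff s)) := (IsUnit.mk0 _ h2).map _
    exact hu.mul_right_eq_zero.1 hc.symm
  exact hb (MonomialOrder.leadingCoeff_eq_zero_iff.1 h3)

lemma generic_inj {K σ : Type*} [Field K] [Infinite K] {d n : ℕ}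
    (M : Matrix (Fin d) (Fin n) (MvPolynomial σ K))
    (hM : ∀ m : Fin n → MvPolynomial σ K, M.mulVec m = 0 → m = 0) :
    ∃ p : σ → K, ∀ a : Fin n → K, (M.map (MvPolynomial.eval p)).mulVec a = 0 → a = 0 := by
  classical
  let S := MvPolynomial σ K
  let E := FractionRing S
  let ME : Matrix (Fin d) (Fin n) E := M.map (algebraMap S E)
  have hME : ∀ m : Fin n → E, ME.mulVec m = 0 → m = 0 := by
    intro m hm
    obtain ⟨b, hb⟩ := IsLocalization.exist_integer_multiples_of_finite (nonZeroDivisors S) m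
    choose m' hm' using hb
    have h1 : M.mulVec m' = 0 := by
      funext i
      apply IsFractionRing.injective S E
      have h2 : algebraMap S E (M.mulVec m' i) = ((b : S) • ME.mulVec m) i := by
        rw [← Matrix.mulVec_smul]
        simp only [Matrix.mulVec, dotProduct, map_sum, map_mul, Pi.smul_apply, hm', ME,
          Matrix.map_apply]
      rw [h2, hm]; simp
    have h3 := hM m' h1
    funext i
    have h4 := hm' i
    rw [h3, Pi.zero_apply, map_zero, Algebra.smul_def] at h4
    have h5 : algebraMap S E b ≠ 0 := by
      rw [Ne, IsFractionRing.to_map_eq_zero_iff]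
      exact nonZeroDivisors.coe_ne_zero b
    exact (mul_eq_zero.1 h4.symm).resolve_left h5
  obtain ⟨g, hg⟩ := LinearMap.exists_leftInverse_of_injective (Matrix.toLin' ME)
    (by rw [LinearMap.ker_eq_bot']; intro m hm; exact hME m (by simpa using hm))
  let L := LinearMap.toMatrix' g
  have hL : L * ME = 1 := by
    rw [← LinearMap.toMatrix'_toLin' ME, ← LinearMap.toMatrix'_comp, hg, LinearMap.toMatrix'_id]
  obtain ⟨b, hb⟩ := IsLocalization.exist_integer_multiples_of_finite (nonZeroDivisors S)
    (fun ij : Fin n × Fin d => L ij.1 ij.2)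
  choose L' hL' using hb
  let L'' : Matrix (Fin n) (Fin d) S := fun i j => L' (i, j)
  have key : L'' * M = (b : S) • (1 : Matrix (Fin n) (Fin n) S) := by
    ext1 i j
    apply IsFractionRing.injective S E
    have h1 : algebraMap S E ((L'' * M) i j) = algebraMap S E b * (L * ME) i j := by
      rw [Matrix.mul_apply, Matrix.mul_apply, map_sum, Finset.mul_sum]
      refine Finset.sum_congr rfl fun k _ => ?_
      have h2 : algebraMap S E (L'' i k) = algebraMap S E b * L i k := by
        rw [← Algebra.smul_def]; exact hL' (i, k)
      have h3 : ME k j = algebraMap S E (M k j) := rfl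
      rw [map_mul, h2, h3, mul_assoc]
    rw [h1, hL]
    by_cases hij : i = j
    · subst hij; simp
    · simp [hij]
  have hb0 : (b : S) ≠ 0 := nonZeroDivisors.coe_ne_zero b
  obtain ⟨p, hp⟩ : ∃ p : σ → K, MvPolynomial.eval p (b : S) ≠ 0 := by
    by_contra! h
    exact hb0 (MvPolynomial.funext (fun p => by rw [h p, map_zero]))
  refine ⟨p, fun a ha => ?_⟩
  have h1 : (L''.map (MvPolynomial.eval p)) * (M.map (MvPolynomial.eval p))
      = (MvPolynomial.eval p (b : S)) • (1 : Matrix (Fin n) (Fin n) K) := by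
    rw [← Matrix.map_mul, key]
    ext i j
    by_cases hij : i = j
    · subst hij; simp
    · simp [hij]
  have h2 := congrArg (fun N => Matrix.mulVec N a) h1
  simp only [← Matrix.mulVec_mulVec, ha, Matrix.mulVec_zero, Matrix.smul_mulVec,
    Matrix.one_mulVec] at h2
  exact (smul_eq_zero.1 h2.symm).resolve_left hp

lemma euler_coeff {A : Type*} [CommRing A] (p : MvPolynomial (Fin 5) A) (n : Fin 5 →₀ ℕ) :
    MvPolynomial.coeff n (∑ i, MvPolynomial.X i * MvPolynomial.pderiv i p)
      = (∑ i, n i) • MvPolynomial.coeff n p := by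
  classical
  induction p using MvPolynomial.induction_on' with
  | add p q hp hq =>
    simp only [map_add, mul_add, Finset.sum_add_distrib, MvPolynomial.coeff_add, hp, hq, smul_add]
  | monomial k a =>
    simp only [MvPolynomial.X_mul_pderiv_monomial, ← Finset.sum_smul, MvPolynomial.coeff_smul]
    by_cases h : k = n
    · subst h; rfl
    · simp [MvPolynomial.coeff_monomial, h]

lemma coeff_mem_mul {K A : Type*} [Field K] [CommRing A] [Algebra K A] (P Q : Submodule K A)
    (a b : MvPolynomial (Fin 5) A) (ha : ∀ n, MvPolynomial.coeff n a ∈ P)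
    (hb : ∀ n, MvPolynomial.coeff n b ∈ Q) (n) : MvPolynomial.coeff n (a * b) ∈ P * Q := by
  classical
  rw [MvPolynomial.coeff_mul]
  exact Submodule.sum_mem _ fun k _ => Submodule.mul_mem_mul (ha _) (hb _)

set_option maxHeartbeats 1000000 in
theorem mid {K A : Type*} [Field K] [CharZero K] [CommRing A] [Algebra K A] (x : Fin 5 → A)
    (hx : LinearIndependent K x) (P : Submodule K A) (hP : P = Submodule.span K (Set.range x))
    (hA1 : ∀ a ∈ P, (∀ i, a * x i = 0) → a = 0)
    (hA2 : ∀ a ∈ P * P, (∀ i, a * x i = 0) → a = 0)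
    (hA3 : ∀ a ∈ P * P * P, (∀ i, a * x i = 0) → a = 0) :
    ∃ c : Fin 5 → K, ∀ a ∈ P, (∑ i, c i • x i) * a = 0 → a = 0 := by
  classical
  have hnt : Nontrivial A := ⟨x 0, 0, hx.ne_zero 0⟩
  have xP : ∀ i, x i ∈ P := fun i => by rw [hP]; exact Submodule.subset_span ⟨i, rfl⟩
  have : Module.Finite K P := by
    rw [hP]; exact Module.Finite.span_of_finite K (Set.finite_range x)
  let W := P * P
  have hWf : Module.Finite K W := by
    rw [Module.Finite.iff_fg]
    have : P.FG := Module.Finite.iff_fg.1 ‹_›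
    exact this.mul this
  let d := Module.finrank K W
  let bs : Module.Basis (Fin d) K W := Module.finBasis K W
  let y : Fin 5 → Fin 5 → W := fun i j => ⟨x i * x j, Submodule.mul_mem_mul (xP i) (xP j)⟩
  let M : Matrix (Fin d) (Fin 5) (MvPolynomial (Fin 5) K) := fun k j =>
    ∑ i, MvPolynomial.X i * MvPolynomial.C (bs.repr (y i j) k)
  have hMapp : ∀ k j, M k j = ∑ i, MvPolynomial.X i * MvPolynomial.C (bs.repr (y i j) k) :=
    fun _ _ => rfl
  by_cases hM : ∀ m : Fin 5 → MvPolynomial (Fin 5) K, M.mulVec m = 0 → m = 0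
  · obtain ⟨p, hp⟩ := generic_inj M hM
    refine ⟨p, fun a ha h0 => ?_⟩
    rw [hP] at ha
    obtain ⟨c, rfl⟩ := (Submodule.mem_span_range_iff_exists_fun K).1 ha
    have hc : c = 0 := by
      apply hp
      have h1 : (∑ j, c j • ∑ i, p i • y i j) = 0 := by
        apply Subtype.ext
        simp only [Submodule.coe_sum, Submodule.coe_smul, y, Submodule.coe_zero]
        rw [← h0, Finset.mul_sum]
        refine Finset.sum_congr rfl fun j _ => ?_
        rw [Finset.sum_mul, Finset.smul_sum]
        refine Finset.sum_congr rfl fun i _ => ?_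
        simp only [Algebra.smul_def]
        ring
      funext k
      have h2 := congrArg (fun w => bs.repr w k) h1
      simp only [map_sum, map_smul, Finsupp.coe_finsetSum, Finset.sum_apply, Finsupp.smul_apply,
        map_zero, Finsupp.zero_apply, smul_eq_mul] at h2
      rw [Pi.zero_apply, ← h2]
      simp only [Matrix.mulVec, dotProduct, Matrix.map_apply, hMapp, map_sum, map_mul,
        MvPolynomial.eval_X, MvPolynomial.eval_C]
      refine Finset.sum_congr rfl fun j _ => by ring
    simp [hc]
  · exfalso
    push Not at hM
    obtain ⟨mv, hmv, hmv0⟩ := hM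
    let _ : Algebra (MvPolynomial (Fin 5) K) (MvPolynomial (Fin 5) A) :=
      (MvPolynomial.map (algebraMap K A)).toAlgebra
    have hsm : ∀ (s : MvPolynomial (Fin 5) K) (b : MvPolynomial (Fin 5) A),
      s • b = MvPolynomial.map (algebraMap K A) s * b := fun _ _ => rfl
    have hTF : Module.IsTorsionFree (MvPolynomial (Fin 5) K) (MvPolynomial (Fin 5) A) := by
      refine Module.IsTorsionFree.mk ?_
      intro s hs b b' h
      have hs0 : s ≠ 0 := hs.ne_zero
      have h' : MvPolynomial.map (algebraMap K A) s * (b - b') = 0 := by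
        have : s • b = s • b' := h
        rw [hsm, hsm] at this
        rw [mul_sub, this, sub_self]
      exact sub_eq_zero.1 ((torsion_aux s _ h').resolve_left hs0)
    let X' : Fin 5 → MvPolynomial (Fin 5) A := fun i => MvPolynomial.C (x i)
    let V := Submodule.span (MvPolynomial (Fin 5) K) (Set.range X')
    have hVc : ∀ b ∈ V, ∀ n, MvPolynomial.coeff n b ∈ P := by
      intro b hb
      induction hb using Submodule.span_induction with
      | mem b hb =>
        obtain ⟨i, rfl⟩ := hb
        intro n
        simp only [X', MvPolynomial.coeff_C]
        split_ifs
        · exact xP i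
        · exact P.zero_mem
      | zero => intro n; simp
      | add a b _ _ ha hb => intro n; rw [MvPolynomial.coeff_add]; exact P.add_mem (ha n) (hb n)
      | smul s b _ hb =>
        intro n
        rw [hsm, MvPolynomial.coeff_mul]
        refine Submodule.sum_mem _ fun k _ => ?_
        rw [MvPolynomial.coeff_map, ← Algebra.smul_def]
        exact P.smul_mem _ (hb _)
    have hkill : ∀ Q : Submodule K A, (∀ a ∈ Q, (∀ i, a * x i = 0) → a = 0) →
        ∀ b : MvPolynomial (Fin 5) A, (∀ n, MvPolynomial.coeff n b ∈ Q) →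
        (∀ i, b * X' i = 0) → b = 0 := by
      intro Q hQ b hb h
      ext n
      rw [MvPolynomial.coeff_zero]
      apply hQ _ (hb n)
      intro i
      have := congrArg (MvPolynomial.coeff n) (h i)
      simpa [X', cmc] using this
    let l : MvPolynomial (Fin 5) A := ∑ i, (MvPolynomial.X i : MvPolynomial (Fin 5) K) • X' i
    let m : MvPolynomial (Fin 5) A := ∑ j, mv j • X' j
    have hmV : m ∈ V := Submodule.sum_mem _ fun j _ => V.smul_mem _ (Submodule.subset_span ⟨j, rfl⟩)
    have hm0 : m ≠ 0 := by
      intro h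
      apply hmv0
      funext j
      ext n
      have h1 := congrArg (MvPolynomial.coeff n) h
      simp only [m, hsm, X', MvPolynomial.coeff_sum, cmc,
        MvPolynomial.coeff_map, MvPolynomial.coeff_zero, ← Algebra.smul_def] at h1
      simpa using (Fintype.linearIndependent_iff.1 hx _ h1 j)
    have hlm : l * m = 0 := by
      have hy : ∀ i j, X' i * X' j = ∑ k, MvPolynomial.map (algebraMap K A)
          (MvPolynomial.C (bs.repr (y i j) k)) * MvPolynomial.C ((bs k : W) : A) := by
        intro i j
        have h1 := congrArg Subtype.val (bs.sum_repr (y i j))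
        simp only [Submodule.coe_sum, Submodule.coe_smul, Algebra.smul_def] at h1
        simp only [MvPolynomial.map_C, ← map_mul, ← map_sum, X', h1, y]
      have h2 : l * m = ∑ k, MvPolynomial.map (algebraMap K A) (M.mulVec mv k)
          * MvPolynomial.C ((bs k : W) : A) := by
        have h3 : ∀ i j, MvPolynomial.map (algebraMap K A) (MvPolynomial.X i) * X' i *
            (MvPolynomial.map (algebraMap K A) (mv j) * X' j)
            = ∑ k, MvPolynomial.map (algebraMap K A) (MvPolynomial.X i) *
              MvPolynomial.map (algebraMap K A) (MvPolynomial.C (bs.repr (y i j) k)) *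
              MvPolynomial.map (algebraMap K A) (mv j) * MvPolynomial.C ((bs k : W) : A) := by
          intro i j
          have h4 : MvPolynomial.map (algebraMap K A) (MvPolynomial.X i) * X' i *
            (MvPolynomial.map (algebraMap K A) (mv j) * X' j)
            = MvPolynomial.map (algebraMap K A) (MvPolynomial.X i) *
              MvPolynomial.map (algebraMap K A) (mv j) * (X' i * X' j) := by ring
          rw [h4, hy, Finset.mul_sum]
          refine Finset.sum_congr rfl fun k _ => by ring
        simp only [l, m, hsm]
        rw [Finset.sum_mul_sum]
        simp only [h3]
        rw [sum3]
        refine Finset.sum_congr rfl fun k _ => ?_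
        rw [Matrix.mulVec, dotProduct, map_sum, Finset.sum_mul]
        refine Finset.sum_congr rfl fun j _ => ?_
        rw [hMapp, map_mul, map_sum, Finset.sum_mul, Finset.sum_mul]
        refine Finset.sum_congr rfl fun i _ => ?_
        rw [map_mul]
      rw [h2, hmv]
      simp
    let D : Fin 5 → Derivation ℤ (MvPolynomial (Fin 5) A) (MvPolynomial (Fin 5) A) :=
      fun i => (MvPolynomial.pderiv i).restrictScalars ℤ
    have hDdef : ∀ i b, D i b = MvPolynomial.pderiv i b := fun _ _ => rfl
    have hDX : ∀ i j, D i (X' j) = 0 := by intro i j; rw [hDdef]; simp [X']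
    have hDs : ∀ i (s : MvPolynomial (Fin 5) K) b,
        D i (s • b) = MvPolynomial.pderiv i s • b + s • D i b := by
      intro i s b
      rw [hsm, hsm, hsm, hDdef, hDdef, MvPolynomial.pderiv_mul, MvPolynomial.pderiv_map]
    have hDl : ∀ i, D i l = X' i := by
      intro i
      simp only [l, map_sum, hDs, hDX, smul_zero, add_zero, MvPolynomial.pderiv_X]
      rw [Finset.sum_eq_single i]
      · simp
      · intro j _ hj; simp [hj]
      · simp
    have hPx : ∀ a ∈ P, a ≠ 0 → ∃ i, a * x i ≠ 0 := by
      intro a ha h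
      by_contra! h'
      exact h (hA1 a ha h')
    have hlcoef : ∀ i, MvPolynomial.coeff (Finsupp.single i 1) l = x i := by
      intro i
      simp only [l, hsm, X', MvPolynomial.map_X, MvPolynomial.coeff_sum, cmc,
        MvPolynomial.coeff_X]
      rw [Finset.sum_eq_single i]
      · simp
      · intro j _ hj
        rw [if_neg, zero_mul]
        intro h
        exact hj (Finsupp.single_left_injective one_ne_zero h)
      · simp
    have hDV : ∀ i, ∀ b ∈ V, D i b ∈ V := by
      intro i b hb
      induction hb using Submodule.span_induction with
      | mem b hb =>
        obtain ⟨j, rfl⟩ := hb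
        rw [hDX]; exact Submodule.zero_mem _
      | zero => rw [map_zero]; exact Submodule.zero_mem _
      | add a b _ _ ha hb => rw [map_add]; exact Submodule.add_mem _ ha hb
      | smul s b hb' hb =>
        rw [hDs]
        exact Submodule.add_mem _ (Submodule.smul_mem _ _ hb') (Submodule.smul_mem _ _ hb)
    have hEul : ¬ (∑ i, (MvPolynomial.X i : MvPolynomial (Fin 5) A) * MvPolynomial.pderiv i m = 0) := by
      intro h
      have h1 : ∀ n, n ≠ 0 → MvPolynomial.coeff n m = 0 := by
        intro n hn
        have h2 := euler_coeff m n
        rw [h, MvPolynomial.coeff_zero] at h2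
        have hs : (∑ i, n i) ≠ 0 := by
          intro h0
          apply hn
          ext i
          simpa using (Finset.sum_eq_zero_iff.1 h0 i (Finset.mem_univ i))
        have h3 : ((∑ i, n i : ℕ) : K) • MvPolynomial.coeff n m = 0 := by
          rw [Nat.cast_smul_eq_nsmul]; exact h2.symm
        exact (smul_eq_zero.1 h3).resolve_left (by exact_mod_cast hs)
      have h4 : m = MvPolynomial.C (MvPolynomial.coeff 0 m) := by
        ext n
        rw [MvPolynomial.coeff_C]
        split_ifs with h5
        · rw [h5]
        · exact h1 n (Ne.symm h5)
      apply hm0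
      rw [h4]
      have h6 : MvPolynomial.coeff 0 m = 0 := by
        apply hA1 _ (hVc m hmV 0)
        intro i
        have h7 := congrArg (MvPolynomial.coeff (Finsupp.single i 1)) hlm
        rw [h4, cmc, hlcoef, MvPolynomial.coeff_zero] at h7
        rw [mul_comm]; exact h7
      rw [h6, map_zero]
    have hEul2 : ∑ i, (MvPolynomial.X i : MvPolynomial (Fin 5) K) • D i m ≠ 0 := by
      intro h
      apply hEul
      rw [← h]
      refine Finset.sum_congr rfl fun i _ => ?_
      rw [hsm, MvPolynomial.map_X, hDdef]
    refine core X' (fun i => MvPolynomial.X i) D hDX hDV l m rfl hDl hmV hm0 hlm ?_ ?_ ?_ ?_ hEul2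
    · intro a ha h
      exact hkill P hA1 a (hVc a ha) h
    · intro a ha b hb h
      exact hkill _ hA2 _ (coeff_mem_mul P P a b (hVc a ha) (hVc b hb)) h
    · intro a ha b hb c hc h
      exact hkill _ hA3 _ (coeff_mem_mul _ P _ c (coeff_mem_mul P P a b (hVc a ha) (hVc b hb))
        (hVc c hc)) h
    · -- l * l ≠ 0
      intro h
      have hll : ∀ i j, x i * x j = 0 := by
        intro i j
        have h1 := congrArg (D i) h
        simp only [Derivation.leibniz, smul_eq_mul, hDl, map_zero] at h1
        have h2 := congrArg (D j) h1
        simp only [Derivation.leibniz, smul_eq_mul, hDl, map_zero, map_add, hDX] at h2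
        have h3 : (2 : MvPolynomial (Fin 5) A) * (X' i * X' j) = 0 := by linear_combination h2
        have h4 : X' i * X' j = 0 :=
          nat_cancel (S := MvPolynomial (Fin 5) K) 2 (by norm_num) _ (by exact_mod_cast h3)
        have h5 : MvPolynomial.C (σ := Fin 5) (x i * x j) = 0 := by rw [map_mul]; exact h4
        exact (MvPolynomial.C_eq_zero).1 h5
      obtain ⟨i, hi⟩ := hPx (x 0) (xP 0) (hx.ne_zero 0)
      exact hi (hll 0 i)

end Mid
section Final

theorem mem_piece_iff' {K : Type*} [Field K] {n : ℕ} (I : Ideal (MvPolynomial (Fin n) K)) (i : ℕ)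
    (a : MvPolynomial (Fin n) K ⧸ I) :
    a ∈ piece I i ↔ ∃ p : MvPolynomial (Fin n) K, p.IsHomogeneous i ∧ Ideal.Quotient.mk I p = a := by
  unfold piece
  simp only [Submodule.mem_map, mem_homogeneousSubmodule]
  rfl

theorem piece_mul_mem {K : Type*} [Field K] {n : ℕ} (I : Ideal (MvPolynomial (Fin n) K)) {i j : ℕ}
    {a b : MvPolynomial (Fin n) K ⧸ I} (ha : a ∈ piece I i) (hb : b ∈ piece I j) :
    a * b ∈ piece I (i + j) := by
  rw [mem_piece_iff'] at *
  obtain ⟨p, hp, rfl⟩ := ha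
  obtain ⟨r, hr, rfl⟩ := hb
  exact ⟨p * r, hp.mul hr, map_mul _ _ _⟩

theorem x_mem_piece {K : Type*} [Field K] {n : ℕ} (I : Ideal (MvPolynomial (Fin n) K))
    (j : Fin n) : Ideal.Quotient.mk I (X j) ∈ piece I 1 :=
  (mem_piece_iff' _ _ _).2 ⟨X j, isHomogeneous_X _ _, rfl⟩

theorem piece_succ_decomp {K : Type*} [Field K] [CharZero K] {n : ℕ}
    (I : Ideal (MvPolynomial (Fin n) K)) {i : ℕ}
    {b : MvPolynomial (Fin n) K ⧸ I} (hb : b ∈ piece I (i + 1)) :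
    ∃ a : Fin n → MvPolynomial (Fin n) K ⧸ I, (∀ j, a j ∈ piece I i) ∧
      b = ∑ j, Ideal.Quotient.mk I (X j) * a j := by
  rw [mem_piece_iff'] at hb
  obtain ⟨p, hp, rfl⟩ := hb
  refine ⟨fun j => ((i + 1 : ℕ) : K)⁻¹ • Ideal.Quotient.mk I (pderiv j p), fun j => ?_, ?_⟩
  · apply Submodule.smul_mem
    exact (mem_piece_iff' _ _ _).2 ⟨_, hp.pderiv, rfl⟩
  · have h1 := congrArg (Ideal.Quotient.mk I) hp.sum_X_mul_pderiv
    simp only [map_sum, map_mul, map_nsmul] at h1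
    simp only [mul_smul_comm, ← Finset.smul_sum]
    rw [h1, ← Nat.cast_smul_eq_nsmul K, smul_smul, inv_mul_cancel₀, one_smul]
    exact_mod_cast Nat.succ_ne_zero i

theorem piece_disjoint {K : Type*} [Field K] {n : ℕ} (I : Ideal (MvPolynomial (Fin n) K))
    (hI : IsHomogIdeal I) {i d : ℕ} (h : i ≠ d)
    {a : MvPolynomial (Fin n) K ⧸ I} (ha : a ∈ piece I i) (hb : a ∈ piece I d) : a = 0 := by
  rw [mem_piece_iff'] at *
  obtain ⟨p, hp, rfl⟩ := ha
  obtain ⟨r, hr, hrp⟩ := hb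
  have h1 : p - r ∈ I := Ideal.Quotient.eq.1 hrp.symm
  have h2 := hI _ h1 i
  rw [map_sub, homogeneousComponent_of_mem ((mem_homogeneousSubmodule _ _).2 hp),
    homogeneousComponent_of_mem ((mem_homogeneousSubmodule _ _).2 hr), if_pos rfl, if_neg h,
    sub_zero] at h2
  exact Ideal.Quotient.eq_zero_iff_mem.2 h2

theorem no_socle {K : Type*} [Field K] {n : ℕ} (I : Ideal (MvPolynomial (Fin n) K)) {d : ℕ}
    (hAG : IsArtinianGorenstein I d) {i : ℕ} (hi : i ≠ d)
    {a : MvPolynomial (Fin n) K ⧸ I} (ha : a ∈ piece I i)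
    (h : ∀ j, a * Ideal.Quotient.mk I (X j) = 0) : a = 0 := by
  refine piece_disjoint I hAG.1 hi ha (hAG.2.2.2.2.2 ?_)
  unfold socle
  rw [Submodule.mem_iInf]
  intro j
  rw [LinearMap.mem_ker, LinearMap.mulLeft_apply, mul_comm]
  exact h j

/-- If `a` of degree `i` kills all of degree `k` and `i + k ≤ d`, then `a = 0`. -/
theorem perfect_aux {K : Type*} [Field K] {n : ℕ} (I : Ideal (MvPolynomial (Fin n) K)) {d : ℕ}
    (hAG : IsArtinianGorenstein I d) (k : ℕ) : ∀ {i : ℕ}, i + k ≤ d →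
    ∀ {a : MvPolynomial (Fin n) K ⧸ I}, a ∈ piece I i →
    (∀ b ∈ piece I k, a * b = 0) → a = 0 := by
  induction k with
  | zero =>
    intro i _ a _ h
    have := h 1 ((mem_piece_iff' _ _ _).2 ⟨1, isHomogeneous_one _ _, map_one _⟩)
    simpa using this
  | succ k ih =>
    intro i hi a ha h
    apply no_socle I hAG (by omega : i ≠ d) ha
    intro j
    apply ih (by omega : (i + 1) + k ≤ d) (piece_mul_mem I ha (x_mem_piece I j))
    intro b hb
    rw [mul_assoc]
    apply h
    rw [add_comm]
    exact piece_mul_mem I (x_mem_piece I j) hb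

theorem piece_finite {K : Type*} [Field K] {n : ℕ} (I : Ideal (MvPolynomial (Fin n) K)) (i : ℕ) :
    Module.Finite K (piece I i) := by
  unfold piece
  have : Module.Finite K (homogeneousSubmodule (Fin n) K i) := by
    rw [Module.Finite.iff_fg]
    exact homogeneousSubmodule_fg (Fin n) K i
  infer_instance

theorem piece_one_eq {K : Type*} [Field K] [CharZero K] {n : ℕ}
    (I : Ideal (MvPolynomial (Fin n) K)) :
    piece I 1 = Submodule.span K (Set.range fun j : Fin n => Ideal.Quotient.mk I (X j)) := by
  apply le_antisymm
  · intro b hb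
    obtain ⟨a, ha, rfl⟩ := piece_succ_decomp I (i := 0) hb
    refine Submodule.sum_mem _ fun j _ => ?_
    obtain ⟨p, hp, hpa⟩ := (mem_piece_iff' _ _ _).1 (ha j)
    rw [← hpa, totalDegree_eq_zero_iff_eq_C.1 (Nat.le_zero.1 hp.totalDegree_le), mul_comm]
    have : Ideal.Quotient.mk I (C (coeff 0 p)) * Ideal.Quotient.mk I (X j)
        = coeff 0 p • Ideal.Quotient.mk I (X j) := by
      rw [← map_mul, ← smul_eq_C_mul]; rfl
    rw [this]
    exact Submodule.smul_mem _ _ (Submodule.subset_span ⟨j, rfl⟩)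
  · rw [Submodule.span_le]
    rintro _ ⟨j, rfl⟩
    exact x_mem_piece I j

theorem dual_surj {K : Type*} [Field K] {n : ℕ} (I : Ideal (MvPolynomial (Fin n) K))
    (hAG : IsArtinianGorenstein I 4) (h1 : hf I 1 = 5) (h3 : hf I 3 = 5) (h4 : hf I 4 = 1)
    (L : MvPolynomial (Fin n) K ⧸ I) (hL : L ∈ piece I 1)
    (hinj : ∀ a ∈ piece I 1, L * a = 0 → a = 0) :
    ∀ b ∈ piece I 3, ∃ a ∈ piece I 2, L * a = b := by
  intro b hb
  by_contra hcon
  have f1 := piece_finite I 1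
  have f3 := piece_finite I 3
  have f4 := piece_finite I 4
  have hN : b ∉ (piece I 2).map (LinearMap.mulLeft K L) := by
    rintro ⟨a, ha, hab⟩
    exact hcon ⟨a, ha, hab⟩
  obtain ⟨f, hfb, hfN⟩ := Submodule.exists_le_ker_of_notMem hN
  have e : piece I 4 ≃ₗ[K] K := LinearEquiv.ofFinrankEq _ _ (by
    rw [Module.finrank_self]; exact h4)
  obtain ⟨g, hg⟩ := LinearMap.exists_extend (e : piece I 4 →ₗ[K] K)
  have hg0 : ∀ a ∈ piece I 4, g a = 0 → a = 0 := by
    intro a ha h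
    have h5 := LinearMap.congr_fun hg ⟨a, ha⟩
    simp only [LinearMap.comp_apply, Submodule.subtype_apply, h, LinearEquiv.coe_coe] at h5
    exact congrArg Subtype.val ((LinearEquiv.map_eq_zero_iff e).1 h5.symm)
  let Φ : piece I 1 →ₗ[K] Module.Dual K (piece I 3) :=
    (piece I 3).subtype.dualMap ∘ₗ
      ((LinearMap.mul K (MvPolynomial (Fin n) K ⧸ I)).compr₂ g) ∘ₗ (piece I 1).subtype
  have hΦ : ∀ a c, Φ a c = g (a.1 * c.1) := fun _ _ => rfl
  have hΦi : Function.Injective Φ := by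
    rw [injective_iff_map_eq_zero]
    intro a ha
    apply Subtype.ext
    apply perfect_aux I hAG 3 (by norm_num) a.2
    intro c hc
    apply hg0 _ (piece_mul_mem I a.2 hc)
    rw [← hΦ a ⟨c, hc⟩, ha]; rfl
  have hΦs : Function.Surjective Φ := by
    refine (LinearMap.injective_iff_surjective_of_finrank_eq_finrank ?_).1 hΦi
    rw [Subspace.dual_finrank_eq]
    exact h1.trans h3.symm
  obtain ⟨a, ha⟩ := hΦs (f ∘ₗ (piece I 3).subtype)
  have hgf : ∀ c ∈ piece I 3, g (a.1 * c) = f c := by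
    intro c hc
    rw [← hΦ a ⟨c, hc⟩, ha]; rfl
  have haL : a.1 * L = 0 := by
    apply perfect_aux I hAG 2 (by norm_num) (piece_mul_mem I a.2 hL)
    intro c hc
    apply hg0 _ (piece_mul_mem I (piece_mul_mem I a.2 hL) hc)
    rw [mul_assoc, hgf _ (piece_mul_mem I hL hc)]
    exact hfN ⟨c, hc, rfl⟩
  have ha0 : a.1 = 0 := hinj _ a.2 (by rw [mul_comm]; exact haL)
  apply hfb
  rw [← hgf b hb, ha0, zero_mul, map_zero]

end Final

/-- Any artinian Gorenstein algebra with h-vector `(1,5,6,5,1)` has the WLP. -/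
theorem wlp_15651 {K : Type*} [Field K] [IsAlgClosed K] [CharZero K]
    (I : Ideal (MvPolynomial (Fin 5) K))
    (hAG : IsArtinianGorenstein I 4)
    (h0 : hf I 0 = 1) (h1 : hf I 1 = 5) (h2 : hf I 2 = 6)
    (h3 : hf I 3 = 5) (h4 : hf I 4 = 1) :
    WLP I := by
  set x : Fin 5 → MvPolynomial (Fin 5) K ⧸ I := fun j => Ideal.Quotient.mk I (X j) with hxdef
  have hP := piece_one_eq I
  have hx : LinearIndependent K x := by
    rw [linearIndependent_iff_card_eq_finrank_span, Set.finrank, ← hP]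
    rw [Fintype.card_fin]; exact h1.symm
  have hPP : piece I 1 * piece I 1 ≤ piece I 2 :=
    Submodule.mul_le.2 fun a ha b hb => piece_mul_mem I ha hb
  have hPPP : piece I 1 * piece I 1 * piece I 1 ≤ piece I 3 :=
    Submodule.mul_le.2 fun a ha b hb => piece_mul_mem I (hPP ha) hb
  obtain ⟨c, hc⟩ := mid x hx (piece I 1) hP
    (fun a ha h => no_socle I hAG (by norm_num) ha h)
    (fun a ha h => no_socle I hAG (by norm_num) (hPP ha) h)
    (fun a ha h => no_socle I hAG (by norm_num) (hPPP ha) h)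
  have hl1 : (∑ i, c i • (X i : MvPolynomial (Fin 5) K)).IsHomogeneous 1 := by
    rw [← mem_homogeneousSubmodule]
    exact Submodule.sum_mem _ fun i _ => Submodule.smul_mem _ _ (isHomogeneous_X _ _)
  have hlq : Ideal.Quotient.mk I (∑ i, c i • (X i : MvPolynomial (Fin 5) K)) = ∑ i, c i • x i := by
    rw [map_sum]; rfl
  refine ⟨∑ i, c i • X i, hl1, fun i => ?_⟩
  rw [hlq]
  set L := ∑ i, c i • x i with hLdef
  have hL : L ∈ piece I 1 := (mem_piece_iff' _ _ _).2 ⟨_, hl1, hlq⟩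
  have hL0 : L ≠ 0 := by
    intro h
    exact hx.ne_zero 0 (hc _ (x_mem_piece I 0) (by rw [h, zero_mul]))
  match i with
  | 0 =>
    left
    intro a ha h
    apply no_socle I hAG (by norm_num : 0 ≠ 4) ha
    intro j
    apply hc
    · have := piece_mul_mem I ha (x_mem_piece I j)
      rwa [zero_add] at this
    · rw [← mul_assoc, h, zero_mul]
  | 1 => exact Or.inl hc
  | 2 => exact Or.inr (dual_surj I hAG h1 h3 h4 L hL hc)
  | 3 =>
    right
    intro b hb
    have h5 : ∃ d ∈ piece I 3, L * d ≠ 0 := by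
      by_contra! h
      exact hL0 (perfect_aux I hAG 3 (by norm_num) hL h)
    obtain ⟨d, hd, hd0⟩ := h5
    have hLd : L * d ∈ piece I 4 := piece_mul_mem I hL hd
    obtain ⟨k, hk⟩ := (finrank_eq_one_iff_of_nonzero' (⟨L * d, hLd⟩ : piece I 4)
      (fun h => hd0 (congrArg Subtype.val h))).1 h4 ⟨b, hb⟩
    refine ⟨k • d, Submodule.smul_mem _ _ hd, ?_⟩
    rw [mul_smul_comm]
    exact congrArg Subtype.val hk
  | i + 4 =>
    right
    intro b hb
    have h5 : hf I (i + 4 + 1) = 0 := hAG.2.2.1 _ (by omega)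
    have := piece_finite I (i + 4 + 1)
    have h6 : piece I (i + 4 + 1) = ⊥ := Submodule.finrank_eq_zero.1 h5
    rw [h6, Submodule.mem_bot] at hb
    exact ⟨0, Submodule.zero_mem _, by rw [hb, mul_zero]⟩
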